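/- Let R be a Bézout domain (an integral domain in which every finitely generated ideal is principal). Then every rectangular matrix over R has a Smith normal form if and only if R satisfies the following condition: for all a, b, c ∈ R with (a, b, c) = R (i.e., the ideal generated by a, b, c is all of R), there exist p, q ∈ R such that (pa, pb + qc) = R. -/

import Mathlib

/-- An m×n matrix `A` over a commutative ring has a Smith normal form: there are
invertible square matrices `P`, `Q` such that `P * A * Q` vanishes off the main
diagonal and each diagonal entry divides the next. -/
def HasSmithNormalForm {R : Type*} [CommRing R] {m n : ℕ}
    (A : Matrix (Fin m) (Fin n) R) : Prop :=
  ∃ (P : Matrix (Fin m) (Fin m) R) (Q : Matrix (Fin n) (Fin n) R),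
    IsUnit P.det ∧ IsUnit Q.det ∧
    (∀ (i : Fin m) (j : Fin n), (i : ℕ) ≠ (j : ℕ) → (P * A * Q) i j = 0) ∧
    (∀ (i : ℕ) (h1 : i + 1 < m) (h2 : i + 1 < n),
      (P * A * Q) ⟨i, Nat.lt_of_succ_lt h1⟩ ⟨i, Nat.lt_of_succ_lt h2⟩ ∣
        (P * A * Q) ⟨i + 1, h1⟩ ⟨i + 1, h2⟩)

namespace Matrix

section bordered

variable {α : Type*}

/-- The block matrix with top left entry `a`, first row `r`, first column `c`
and remaining block `B`. -/
def bordered {m n : ℕ} (a : α) (r : Fin n → α) (c : Fin m → α) (B : Matrix (Fin m) (Fin n) α) :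
    Matrix (Fin (m + 1)) (Fin (n + 1)) α :=
  of (Fin.cons (Fin.cons a r) fun i => Fin.cons (c i) (B i))

variable {m n : ℕ} (a : α) (r : Fin n → α) (c : Fin m → α) (B : Matrix (Fin m) (Fin n) α)

@[simp] theorem bordered_zero_zero : bordered a r c B 0 0 = a := rfl
@[simp] theorem bordered_zero_succ (j : Fin n) : bordered a r c B 0 j.succ = r j := rfl
@[simp] theorem bordered_succ_zero (i : Fin m) : bordered a r c B i.succ 0 = c i := rfl
@[simp] theorem bordered_succ_succ (i : Fin m) (j : Fin n) :
    bordered a r c B i.succ j.succ = B i j := rfl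

end bordered

end Matrix

section BezoutDomain

variable {R : Type*} [CommRing R]

theorem Ideal.span_pair_eq_top_iff {a b : R} :
    Ideal.span {a, b} = (⊤ : Ideal R) ↔ ∃ x y, x * a + y * b = 1 := by
  rw [Ideal.eq_top_iff_one, Ideal.mem_span_pair]

theorem Ideal.span_triple_eq_top_iff {a b c : R} :
    Ideal.span {a, b, c} = (⊤ : Ideal R) ↔ ∃ x y z, x * a + y * b + z * c = 1 := by
  rw [Ideal.eq_top_iff_one]
  exact Submodule.mem_span_triple

theorem IsBezout.exists_eq_mul_isCoprime [IsDomain R] [IsBezout R] (a b : R) :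
    ∃ d α β x y : R, a = d * α ∧ b = d * β ∧ x * α + y * β = 1 := by
  obtain ⟨x, y, h⟩ := IsBezout.gcd_eq_sum a b
  obtain ⟨α, hα⟩ := IsBezout.gcd_dvd_left a b
  obtain ⟨β, hβ⟩ := IsBezout.gcd_dvd_right a b
  generalize IsBezout.gcd a b = d at h hα hβ
  rcases eq_or_ne d 0 with rfl | hd
  · exact ⟨0, 1, 0, 1, 0, by simpa using hα, by simpa using hβ, by ring⟩
  · refine ⟨d, α, β, x, y, hα, hβ, mul_left_cancel₀ hd ?_⟩
    linear_combination h - x * hα - y * hβ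

theorem exists_bilinear_dvd_two_by_two [IsDomain R] [IsBezout R]
    (H : ∀ a b c : R, Ideal.span {a, b, c} = (⊤ : Ideal R) →
      ∃ p q : R, Ideal.span {p * a, p * b + q * c} = (⊤ : Ideal R)) (a b c d : R) :
    ∃ p q s t g : R, g = p * (a * s + b * t) + q * (c * s + d * t) ∧
      g ∣ a ∧ g ∣ d := by
  obtain ⟨e, α, β, x, y, rfl, rfl, h⟩ := IsBezout.exists_eq_mul_isCoprime a c
  obtain ⟨k, γ, δ, z, w, hk₁, hk₂, hk⟩ :=
    IsBezout.exists_eq_mul_isCoprime (x * b + y * d) (-β * b + α * d)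
  obtain ⟨g, ε, ζ, u, v, rfl, rfl, hg⟩ := IsBezout.exists_eq_mul_isCoprime e k
  have hd : d = g * ζ * (β * γ + x * δ) := by
    linear_combination β * hk₁ + x * hk₂ - d * h
  obtain ⟨p, q, hpq⟩ := H ε (ζ * γ) (ζ * δ) (Ideal.span_triple_eq_top_iff.2
    ⟨u, v * z, v * w, by linear_combination hg + v * ζ * hk⟩)
  obtain ⟨s, t, hst⟩ := Ideal.span_pair_eq_top_iff.1 hpq
  refine ⟨p * x - q * β, p * y + q * α, s, t, g, ?_, ?_, ?_⟩
  · linear_combination (-g) * hst - p * g * ε * s * h - p * t * hk₁ - q * t * hk₂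
  · exact ⟨ε * α, by ring⟩
  · exact ⟨_, hd.trans (mul_assoc _ _ _)⟩

section Bilinear

variable {M N : Type*} [AddCommGroup M] [AddCommGroup N] [Module R M] [Module R N]

/-- Some value of the bilinear form `f` on `S × T` divides every value of `f` on `S × T`. -/
def LinearMap.HasDividingValue (f : M →ₗ[R] N →ₗ[R] R)
    (S : Submodule R M) (T : Submodule R N) : Prop :=
  ∃ u ∈ S, ∃ v ∈ T, ∀ x ∈ S, ∀ y ∈ T, f u v ∣ f x y

theorem LinearMap.HasDividingValue.flip {f : M →ₗ[R] N →ₗ[R] R} {S : Submodule R M}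
    {T : Submodule R N} (h : f.HasDividingValue S T) : f.flip.HasDividingValue T S := by
  obtain ⟨u, hu, v, hv, h⟩ := h
  exact ⟨v, hv, u, hu, fun y hy x hx => h x hx y hy⟩

theorem LinearMap.HasDividingValue.sup_left [IsDomain R] [IsBezout R]
    (H : ∀ a b c : R, Ideal.span {a, b, c} = (⊤ : Ideal R) →
      ∃ p q : R, Ideal.span {p * a, p * b + q * c} = (⊤ : Ideal R))
    {f : M →ₗ[R] N →ₗ[R] R} {S₁ S₂ : Submodule R M} {T : Submodule R N}
    (h₁ : f.HasDividingValue S₁ T) (h₂ : f.HasDividingValue S₂ T) :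
    f.HasDividingValue (S₁ ⊔ S₂) T := by
  obtain ⟨u₁, hu₁, v₁, hv₁, h₁⟩ := h₁
  obtain ⟨u₂, hu₂, v₂, hv₂, h₂⟩ := h₂
  obtain ⟨p, q, s, t, g, hg, ha, hd⟩ :=
    exists_bilinear_dvd_two_by_two H (f u₁ v₁) (f u₁ v₂) (f u₂ v₁) (f u₂ v₂)
  have hval : f (p • u₁ + q • u₂) (s • v₁ + t • v₂) = g := by
    simp only [map_add, map_smul, LinearMap.add_apply, LinearMap.smul_apply, smul_eq_mul, hg]
    ring
  refine ⟨p • u₁ + q • u₂, Submodule.add_mem_sup (S₁.smul_mem _ hu₁) (S₂.smul_mem _ hu₂),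
    s • v₁ + t • v₂, T.add_mem (T.smul_mem _ hv₁) (T.smul_mem _ hv₂), fun x hx y hy => ?_⟩
  obtain ⟨x₁, hx₁, x₂, hx₂, rfl⟩ := Submodule.mem_sup.1 hx
  rw [hval, map_add, LinearMap.add_apply]
  exact dvd_add (ha.trans (h₁ _ hx₁ _ hy)) (hd.trans (h₂ _ hx₂ _ hy))

theorem LinearMap.hasDividingValue_of_fg [IsDomain R] [IsBezout R]
    (H : ∀ a b c : R, Ideal.span {a, b, c} = (⊤ : Ideal R) →
      ∃ p q : R, Ideal.span {p * a, p * b + q * c} = (⊤ : Ideal R))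
    (f : M →ₗ[R] N →ₗ[R] R) {S : Submodule R M} {T : Submodule R N} (hS : S.FG) (hT : T.FG) :
    f.HasDividingValue S T := by
  induction S, hS using Submodule.fg_induction with
  | sup S₁ S₂ _ _ h₁ h₂ => exact h₁.sup_left H h₂
  | singleton x =>
    induction T, hT using Submodule.fg_induction with
    | sup T₁ T₂ _ _ h₁ h₂ => exact (h₁.flip.sup_left H h₂.flip).flip
    | singleton y =>
      refine ⟨x, Submodule.mem_span_singleton_self x, y, Submodule.mem_span_singleton_self y,
        fun x' hx y' hy => ?_⟩
      obtain ⟨a, rfl⟩ := Submodule.mem_span_singleton.1 hx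
      obtain ⟨b, rfl⟩ := Submodule.mem_span_singleton.1 hy
      exact ⟨a * b, by simp; ring⟩

end Bilinear

namespace Matrix

theorem dvd_mul_mul_apply {l m n o : Type*} [Fintype m] [Fintype n] {g : R}
    {A : Matrix m n R} (h : ∀ i j, g ∣ A i j) (P : Matrix l m R) (Q : Matrix n o R) (i : l) (j : o) :
    g ∣ (P * A * Q) i j := by
  simp only [mul_apply]
  exact Finset.dvd_sum fun k _ => (Finset.dvd_sum fun k' _ => (h _ _).mul_left _).mul_right _

theorem mul_mul_mul_mul_mul {m n : Type*} [Fintype m] [Fintype n] (S P : Matrix m m R)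
    (A : Matrix m n R) (Q T : Matrix n n R) : S * P * A * (Q * T) = S * (P * A * Q) * T := by
  simp only [Matrix.mul_assoc]

section bordered

variable {m n : ℕ} (a : R) (r : Fin n → R) (c : Fin m → R) (B : Matrix (Fin m) (Fin n) R)

theorem bordered_mul {l : ℕ} (a' : R) (r' : Fin l → R) (c' : Fin n → R)
    (B' : Matrix (Fin n) (Fin l) R) :
    bordered a r c B * bordered a' r' c' B' =
      bordered (a * a' + r ⬝ᵥ c') (a • r' + r ᵥ* B') (a' • c + B *ᵥ c')
        (vecMulVec c r' + B * B') := by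
  ext i j
  cases i using Fin.cases <;> cases j using Fin.cases <;>
    simp [mul_apply, Fin.sum_univ_succ, dotProduct, vecMul, mulVec, vecMulVec_apply, mul_comm]

theorem det_bordered_of_col_zero (B : Matrix (Fin n) (Fin n) R) :
    (bordered a r 0 B).det = a * B.det := by
  rw [det_succ_column_zero, Fin.sum_univ_succ]
  simp only [bordered_zero_zero, bordered_succ_zero]
  simp
  rfl

theorem det_bordered_of_row_zero (c : Fin n → R) (B : Matrix (Fin n) (Fin n) R) :
    (bordered a 0 c B).det = a * B.det := by
  rw [det_succ_row_zero, Fin.sum_univ_succ]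
  simp only [bordered_zero_zero, bordered_zero_succ]
  simp
  rfl

end bordered

theorem exists_det_eq_one_smul_row_zero_eq [IsDomain R] [IsBezout R] {n : ℕ}
    (u : Fin (n + 1) → R) :
    ∃ (d : R) (M : Matrix (Fin (n + 1)) (Fin (n + 1)) R), M.det = 1 ∧ u = d • M 0 := by
  induction n with
  | zero =>
    refine ⟨u 0, 1, det_one, ?_⟩
    ext i
    fin_cases i
    simp
  | succ n ih =>
    obtain ⟨d, M, hM, hu⟩ := ih (Fin.tail u)
    obtain ⟨e, α, β, x, y, h₁, h₂, h⟩ := IsBezout.exists_eq_mul_isCoprime (u 0) d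
    refine ⟨e, bordered α (β • M 0) (Fin.cons (-y) 0) (M.updateRow 0 (x • M 0)), ?_, ?_⟩
    · rw [det_succ_column_zero, Fin.sum_univ_succ, Fin.sum_univ_succ]
      have e₀ : (bordered α (β • M 0) (Fin.cons (-y) 0) (M.updateRow 0 (x • M 0))).submatrix
          (Fin.succAbove 0) Fin.succ = M.updateRow 0 (x • M 0) := rfl
      have e₁ : (bordered α (β • M 0) (Fin.cons (-y) 0) (M.updateRow 0 (x • M 0))).submatrix
          (Fin.succAbove (Fin.succ 0)) Fin.succ = M.updateRow 0 (β • M 0) := by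
        ext i j
        cases i using Fin.cases with
        | zero => simp
        | succ i => simp
      rw [e₀, e₁, det_updateRow_smul, det_updateRow_smul, updateRow_eq_self, hM]
      simp only [bordered_zero_zero, bordered_succ_zero]
      simp
      linear_combination h
    · ext j
      cases j using Fin.cases with
      | zero => simpa using h₁
      | succ j =>
        have := congrFun hu j
        simp only [Fin.tail] at this
        simp [this, h₂, mul_assoc]

theorem exists_mul_mul_zero_zero_dvd [IsDomain R] [IsBezout R]
    (H : ∀ a b c : R, Ideal.span {a, b, c} = (⊤ : Ideal R) →
      ∃ p q : R, Ideal.span {p * a, p * b + q * c} = (⊤ : Ideal R)) {m n : ℕ}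
    (A : Matrix (Fin (m + 1)) (Fin (n + 1)) R) :
    ∃ (P : Matrix (Fin (m + 1)) (Fin (m + 1)) R) (Q : Matrix (Fin (n + 1)) (Fin (n + 1)) R),
      P.det = 1 ∧ Q.det = 1 ∧ ∀ i j, (P * A * Q) 0 0 ∣ (P * A * Q) i j := by
  obtain ⟨u, -, v, -, h⟩ := (toLinearMap₂' R A).hasDividingValue_of_fg H
    (Module.Finite.fg_top (R := R)) (Module.Finite.fg_top (R := R))
  obtain ⟨d, P, hP, rfl⟩ := exists_det_eq_one_smul_row_zero_eq u
  obtain ⟨e, Q, hQ, rfl⟩ := exists_det_eq_one_smul_row_zero_eq v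
  have h00 : (P * A * Qᵀ) 0 0 = toLinearMap₂' R A (P 0) (Q 0) := by
    rw [toLinearMap₂'_apply', dotProduct_mulVec, mul_apply]
    rfl
  have hdvd (i : Fin (m + 1)) (j : Fin (n + 1)) : (P * A * Qᵀ) 0 0 ∣ A i j := by
    have hij : toLinearMap₂' R A (Pi.single i (1 : R)) (Pi.single j (1 : R)) = A i j := by
      rw [toLinearMap₂'_apply', single_one_dotProduct, mulVec_single_one, col_apply]
    rw [h00, ← hij]
    refine Dvd.dvd.trans ⟨d * e, ?_⟩
      (h (Pi.single i 1) Submodule.mem_top (Pi.single j 1) Submodule.mem_top)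
    rw [map_smul, map_smul, LinearMap.smul_apply, smul_eq_mul, smul_eq_mul]
    ring
  exact ⟨P, Qᵀ, hP, by rwa [det_transpose], dvd_mul_mul_apply hdvd P Qᵀ⟩

theorem exists_mul_mul_eq_bordered [IsDomain R] [IsBezout R]
    (H : ∀ a b c : R, Ideal.span {a, b, c} = (⊤ : Ideal R) →
      ∃ p q : R, Ideal.span {p * a, p * b + q * c} = (⊤ : Ideal R)) {m n : ℕ}
    (A : Matrix (Fin (m + 1)) (Fin (n + 1)) R) :
    ∃ (P : Matrix (Fin (m + 1)) (Fin (m + 1)) R) (Q : Matrix (Fin (n + 1)) (Fin (n + 1)) R)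
      (g : R) (B : Matrix (Fin m) (Fin n) R),
      P.det = 1 ∧ Q.det = 1 ∧ P * A * Q = bordered g 0 0 B ∧ ∀ i j, g ∣ B i j := by
  obtain ⟨P, Q, hP, hQ, h⟩ := exists_mul_mul_zero_zero_dvd H A
  choose k hk using h
  set g := (P * A * Q) 0 0
  set r : Fin n → R := fun j => k 0 j.succ
  set c : Fin m → R := fun i => k i.succ 0
  set K : Matrix (Fin m) (Fin n) R := of fun i j => k i.succ j.succ
  have hA : P * A * Q = bordered g (g • r) (g • c) (g • K) := by
    ext i j
    cases i using Fin.cases <;> cases j using Fin.cases <;> first | rfl | exact hk _ _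
  refine ⟨bordered 1 0 (-c) 1 * P, Q * bordered 1 (-r) 0 1, g, g • (K - vecMulVec c r),
    ?_, ?_, ?_, fun i j => ⟨_, rfl⟩⟩
  · rw [det_mul, det_bordered_of_row_zero, hP]; simp
  · rw [det_mul, det_bordered_of_col_zero, hQ]; simp
  · rw [mul_mul_mul_mul_mul, hA, bordered_mul, bordered_mul]
    ext i j
    cases i using Fin.cases <;> cases j using Fin.cases <;>
      simp [vecMulVec_apply]
    ring

end Matrix

open Matrix in
theorem hasSmithNormalForm_of_span_pair_eq_top [IsDomain R] [IsBezout R]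
    (H : ∀ a b c : R, Ideal.span {a, b, c} = (⊤ : Ideal R) →
      ∃ p q : R, Ideal.span {p * a, p * b + q * c} = (⊤ : Ideal R)) {m n : ℕ}
    (A : Matrix (Fin m) (Fin n) R) : HasSmithNormalForm A := by
  induction m generalizing n with
  | zero => exact ⟨1, 1, by simp, by simp, fun i => i.elim0, fun i h => absurd h (by simp)⟩
  | succ m ih =>
    cases n with
    | zero => exact ⟨1, 1, by simp, by simp, fun _ j => j.elim0, fun i _ h => absurd h (by simp)⟩
    | succ n =>
      obtain ⟨P, Q, g, B, hP, hQ, hA, hB⟩ := exists_mul_mul_eq_bordered H A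
      obtain ⟨P', Q', hP', hQ', hdiag, hdvd⟩ := ih B
      have key : bordered 1 0 0 P' * P * A * (Q * bordered 1 0 0 Q') =
          bordered g 0 0 (P' * B * Q') := by
        rw [mul_mul_mul_mul_mul, hA, bordered_mul, bordered_mul]
        simp
      refine ⟨bordered 1 0 0 P' * P, Q * bordered 1 0 0 Q', ?_, ?_, ?_, ?_⟩
      · rwa [det_mul, det_bordered_of_row_zero, hP, one_mul, mul_one]
      · rwa [det_mul, det_bordered_of_row_zero, hQ, one_mul, one_mul]
      · rw [key]
        intro i j hij
        cases i using Fin.cases <;> cases j using Fin.cases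
        · exact absurd rfl hij
        · rfl
        · rfl
        · exact hdiag _ _ fun h => hij (congrArg Nat.succ h)
      · rw [key]
        intro i h₁ h₂
        cases i with
        | zero =>
          exact dvd_mul_mul_apply hB P' Q' ⟨0, Nat.lt_of_succ_lt_succ h₁⟩
            ⟨0, Nat.lt_of_succ_lt_succ h₂⟩
        | succ i => exact hdvd i (Nat.lt_of_succ_lt_succ h₁) (Nat.lt_of_succ_lt_succ h₂)

open Matrix in
theorem HasSmithNormalForm.exists_span_pair_eq_top {a b c : R}
    (hA : HasSmithNormalForm !![a, b; 0, c]) (h : Ideal.span {a, b, c} = (⊤ : Ideal R)) :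
    ∃ p q : R, Ideal.span {p * a, p * b + q * c} = (⊤ : Ideal R) := by
  obtain ⟨P, Q, hP, hQ, hdiag, hdvd⟩ := hA
  set A := !![a, b; 0, c] with hAdef
  have hD : ∀ i j, (P * A * Q) 0 0 ∣ (P * A * Q) i j := by
    intro i j
    fin_cases i <;> fin_cases j
    · exact dvd_rfl
    · exact (hdiag 0 1 (by simp)).symm ▸ dvd_zero _
    · exact (hdiag 1 0 (by simp)).symm ▸ dvd_zero _
    · exact hdvd 0 (by simp) (by simp)
  have hdA : ∀ i j, (P * A * Q) 0 0 ∣ A i j := by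
    have : A = P⁻¹ * (P * A * Q) * Q⁻¹ := by
      rw [Matrix.mul_assoc P, nonsing_inv_mul_cancel_left _ _ hP, mul_nonsing_inv_cancel_right _ _ hQ]
    intro i j
    conv_rhs => rw [this]
    exact dvd_mul_mul_apply hD _ _ _ _
  obtain ⟨x, y, z, hxyz⟩ := Ideal.span_triple_eq_top_iff.1 h
  obtain ⟨k, hk⟩ : (P * A * Q) 0 0 ∣ 1 := by
    rw [← hxyz]
    exact dvd_add (dvd_add ((hdA 0 0).mul_left _) ((hdA 0 1).mul_left _)) ((hdA 1 1).mul_left _)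
  refine ⟨P 0 0, P 0 1, Ideal.span_pair_eq_top_iff.2 ⟨k * Q 0 0, k * Q 1 0, ?_⟩⟩
  simp [hAdef, mul_apply, Fin.sum_univ_two] at hk
  linear_combination -hk

end BezoutDomain

/-- A Bézout domain `R` is an elementary divisor domain (every rectangular
matrix over `R` has a Smith normal form) if and only if for all `a, b, c ∈ R` with
`(a, b, c) = R` there exist `p, q ∈ R` such that `(pa, pb + qc) = R`. -/
theorem stmt5 (R : Type*) [CommRing R] [IsDomain R] [IsBezout R] :
    (∀ (m n : ℕ) (A : Matrix (Fin m) (Fin n) R), HasSmithNormalForm A) ↔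
      (∀ a b c : R, Ideal.span {a, b, c} = (⊤ : Ideal R) →
        ∃ p q : R, Ideal.span {p * a, p * b + q * c} = (⊤ : Ideal R)) := by
  exact ⟨fun h a b c => (h 2 2 !![a, b; 0, c]).exists_span_pair_eq_top,
    fun H _ _ A => hasSmithNormalForm_of_span_pair_eq_top H A⟩
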